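/- Let K be a locally λ-presentable category and (E,M) any λ-convenient factorization system on K. Then K is M-locally λ-generated. -/

import Mathlib

open CategoryTheory CategoryTheory.Limits Opposite

universe w v u u₂

namespace LocallyGen

variable {K : Type u} [Category.{v} K]

/-- `m` has the unique right lifting property w.r.t. `e`
(every commutative square has a unique diagonal filler). -/
def UniqueLift {A B X Y : K} (e : A ⟶ B) (m : X ⟶ Y) : Prop :=
  ∀ (u : A ⟶ X) (v : B ⟶ Y), u ≫ m = e ≫ v →
    ∃! d : B ⟶ X, e ≫ d = u ∧ d ≫ m = v

/-- An (orthogonal) factorization system `(E, M)` on `K`: both classes contain all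
isomorphisms and are closed under composition, every morphism factors as an `E`-morphism
followed by an `M`-morphism, and `E` is orthogonal to `M`. -/
structure FactorizationSystem (K : Type u) [Category.{v} K] where
  E : MorphismProperty K
  M : MorphismProperty K
  E_iso : ∀ {A B : K} (f : A ⟶ B), IsIso f → E f
  M_iso : ∀ {A B : K} (f : A ⟶ B), IsIso f → M f
  E_comp : ∀ {A B C : K} (f : A ⟶ B) (g : B ⟶ C), E f → E g → E (f ≫ g)
  M_comp : ∀ {A B C : K} (f : A ⟶ B) (g : B ⟶ C), M f → M g → M (f ≫ g)
  factor : ∀ {A B : K} (f : A ⟶ B), ∃ (C : K) (e : A ⟶ C) (m : C ⟶ B), E e ∧ M m ∧ e ≫ m = f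
  orth : ∀ {A B X Y : K} (e : A ⟶ B) (m : X ⟶ Y), E e → M m → UniqueLift e m

/-- A preorder is `κ`-directed if every subset of cardinality `< κ` has an upper bound. -/
def CardinalDirected (I : Type w) [Preorder I] (κ : Cardinal.{w}) : Prop :=
  ∀ S : Set I, Cardinal.mk S < κ → ∃ i : I, ∀ j ∈ S, j ≤ i

/-- All connecting morphisms of a diagram indexed by a preorder lie in `M`. -/
def DiagramInM (M : MorphismProperty K) {I : Type w} [Preorder I] (D : I ⥤ K) : Prop :=
  ∀ ⦃i j : I⦄ (h : i ≤ j), M (D.map (homOfLE h))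

/-- `A` is `κ`-generated w.r.t. `M`: the hom-functor `K(A, -) : K ⥤ Type` preserves
`κ`-directed colimits of `M`-morphisms. -/
def IsGenerated (M : MorphismProperty K) (κ : Cardinal.{v}) (A : K) : Prop :=
  ∀ (I : Type v) [Preorder I], CardinalDirected I κ →
    ∀ (D : I ⥤ K), DiagramInM M D →
      ∀ (c : Cocone D), IsColimit c →
        Nonempty (IsColimit ((coyoneda.obj (op A)).mapCocone c))

/-- A small category is `κ`-small if it has fewer than `κ` morphisms. -/
def IsCardinalSmall (J : Type w) [SmallCategory J] (κ : Cardinal.{w}) : Prop :=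
  Cardinal.mk (Σ (a : J) (b : J), a ⟶ b) < κ

/-- Two `E`-quotients of `A` are isomorphic as quotients. -/
def QuotientRel (E : MorphismProperty K) (A : K)
    (p q : Σ B : K, {e : A ⟶ B // E e}) : Prop :=
  ∃ i : p.1 ≅ q.1, p.2.1 ≫ i.hom = q.2.1

/-- The factorization system `(E, M)` is `κ`-convenient: `K` is `E`-cowellpowered and
`M` is closed under `κ`-directed colimits. -/
structure Convenient (F : FactorizationSystem K) (κ : Cardinal.{v}) : Prop where
  cowellpowered : ∀ A : K, Small.{v} (Quot (QuotientRel F.E A))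
  M_cocone : ∀ (I : Type v) [Preorder I], CardinalDirected I κ →
      ∀ (D : I ⥤ K), DiagramInM F.M D → ∀ (c : Cocone D), IsColimit c →
        ∀ i : I, F.M (c.ι.app i)
  M_desc : ∀ (I : Type v) [Preorder I], CardinalDirected I κ →
      ∀ (D : I ⥤ K), DiagramInM F.M D → ∀ (c : Cocone D) (hc : IsColimit c)
        (c' : Cocone D), (∀ i : I, F.M (c'.ι.app i)) → F.M (hc.desc c')

/-- A presentation of `X` as a `κ`-directed colimit of objects from `S`
and morphisms from `M`. -/
structure DirectedColimitPresentation (M : MorphismProperty K) (κ : Cardinal.{v})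
    (S : Set K) (X : K) where
  I : Type v
  [instI : Preorder I]
  directed : CardinalDirected I κ
  D : I ⥤ K
  mem : ∀ i : I, D.obj i ∈ S
  inM : DiagramInM M D
  c : Cocone D
  pt_eq : c.pt = X
  isColimit : IsColimit c

/-- `K` is `M`-locally `κ`-generated, with witnessing set (of objects) `S`:
`K` is cocomplete, `(E, M)` is `κ`-convenient, `S` is a set of `κ`-generated objects
w.r.t. `M`, and every object of `K` is a `κ`-directed colimit of objects from `S`
and morphisms from `M`. -/
structure IsLocallyGenerated (F : FactorizationSystem K) (κ : Cardinal.{v})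
    (S : Set K) : Prop where
  hasColimits : HasColimits K
  convenient : Convenient F κ
  small : Small.{v} S
  gen : ∀ A ∈ S, IsGenerated F.M κ A
  presentation : ∀ X : K, Nonempty (DirectedColimitPresentation F.M κ S X)

/-- `K` is locally `κ`-presentable: cocomplete with a set `S` of `κ`-presentable objects
such that every object is a `κ`-directed colimit of objects from `S`. -/
def LocallyPresentable (K : Type u) [Category.{v} K] (κ : Cardinal.{v}) : Prop :=
  HasColimits K ∧ ∃ S : Set K, Small.{v} S ∧
    (∀ A ∈ S, IsGenerated (⊤ : MorphismProperty K) κ A) ∧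
    ∀ X : K, Nonempty (DirectedColimitPresentation (⊤ : MorphismProperty K) κ S X)


theorem FactorizationSystem.M_cancel (F : FactorizationSystem K) {A B C : K}
    (f : A ⟶ B) (g : B ⟶ C) (hg : F.M g) (hfg : F.M (f ≫ g)) : F.M f := by
  obtain ⟨Z, e, m, he, hm, rfl⟩ := F.factor f
  obtain ⟨d, ⟨hd1, hd2⟩, -⟩ := F.orth e _ he hfg (𝟙 A) (m ≫ g) (by simp)
  obtain ⟨d', -, hu⟩ := F.orth e _ he (F.M_comp m g hm hg) e (m ≫ g) rfl
  have h1 : d ≫ e = d' := hu _ ⟨by rw [← Category.assoc, hd1, Category.id_comp],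
    by simpa using hd2⟩
  have h2 : 𝟙 Z = d' := hu _ ⟨by simp, by simp⟩
  have : IsIso e := ⟨d, hd1, h1.trans h2.symm⟩
  exact F.M_comp _ _ (F.M_iso e this) hm

theorem CardinalDirected.isFiltered {I : Type v} [Preorder I] {κ : Cardinal.{v}}
    (hκ : κ.IsRegular) (h : CardinalDirected I κ) : IsFiltered I := by
  have : Nonempty I := by
    obtain ⟨i, -⟩ := h ∅ (by simpa using hκ.pos)
    exact ⟨i⟩
  have : IsDirectedOrder I := ⟨fun a b => by
    obtain ⟨i, hi⟩ := h {a, b}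
      (lt_of_lt_of_le (Cardinal.lt_aleph0_of_finite _) hκ.aleph0_le)
    exact ⟨i, hi a (by simp), hi b (by simp)⟩⟩
  infer_instance

theorem isGenerated_quotient (F : FactorizationSystem K) {κ : Cardinal.{v}} (hκ : κ.IsRegular)
    (hconv : Convenient F κ) {A B : K} (hA : IsGenerated (⊤ : MorphismProperty K) κ A)
    (e : A ⟶ B) (he : F.E e) : IsGenerated F.M κ B := by
  intro I _ hI D hD c hc
  have := hI.isFiltered hκ
  obtain ⟨hA⟩ := hA I hI D (fun _ _ _ => trivial) c hc
  have hM := hconv.M_cocone I hI D hD c hc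
  refine ⟨Types.FilteredColimit.isColimitOf' _ _ ?_ ?_⟩
  · intro (f : B ⟶ c.pt)
    obtain ⟨i, (u : A ⟶ D.obj i), (hu : u ≫ c.ι.app i = e ≫ f)⟩ :=
      Types.jointly_surjective_of_isColimit hA (e ≫ f)
    obtain ⟨d, ⟨-, hd⟩, -⟩ := F.orth e _ he (hM i) u f hu
    exact ⟨i, d, hd.symm⟩
  · intro i (x : B ⟶ D.obj i) (y : B ⟶ D.obj i) (h : x ≫ c.ι.app i = y ≫ c.ι.app i)
    have h' : (e ≫ x) ≫ c.ι.app i = (e ≫ y) ≫ c.ι.app i := by simp [h]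
    obtain ⟨j, g, (hg : (e ≫ x) ≫ D.map g = (e ≫ y) ≫ D.map g)⟩ :=
      (Types.FilteredColimit.isColimit_eq_iff' hA (i := i) (e ≫ x) (e ≫ y)).1 h'
    refine ⟨j, g, ?_⟩
    change x ≫ D.map g = y ≫ D.map g
    obtain ⟨d, -, hu⟩ := F.orth e _ he (hM j) ((e ≫ x) ≫ D.map g) (x ≫ c.ι.app i) (by simp)
    rw [hu (x ≫ D.map g) ⟨by simp, by simp⟩, hu (y ≫ D.map g) ⟨by simp [hg], by simp [h]⟩]

theorem quotientRel_equivalence (E : MorphismProperty K) (A : K) :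
    Equivalence (QuotientRel E A) where
  refl _ := ⟨Iso.refl _, by simp⟩
  symm := fun ⟨i, hi⟩ => ⟨i.symm, by simp [← hi]⟩
  trans := fun ⟨i, hi⟩ ⟨j, hj⟩ => ⟨i ≪≫ j, by simp [← hi, ← hj]⟩

/-- Representatives of the `E`-quotients of objects of `S`. -/
def quotientSet (F : FactorizationSystem K) (S : Set K) : Set K :=
  Set.range (fun p : Σ A : S, Quot (QuotientRel F.E A.1) => p.2.out.1)

theorem factor_mem (F : FactorizationSystem K) (S : Set K) {A X : K} (hA : A ∈ S) (f : A ⟶ X) :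
    ∃ (B : K) (e : A ⟶ B) (m : B ⟶ X), B ∈ quotientSet F S ∧ F.E e ∧ F.M m ∧ e ≫ m = f := by
  obtain ⟨C, e, m, he, hm, rfl⟩ := F.factor f
  let q : Quot (QuotientRel F.E A) := Quot.mk _ ⟨C, e, he⟩
  obtain ⟨i, hi⟩ : QuotientRel F.E A q.out ⟨C, e, he⟩ :=
    (quotientRel_equivalence F.E A).eqvGen_iff.1 (Quot.eqvGen_exact (Quot.out_eq q))
  refine ⟨q.out.1, q.out.2.1, i.hom ≫ m, ⟨⟨⟨A, hA⟩, q⟩, rfl⟩, q.out.2.2,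
    F.M_comp _ _ (F.M_iso _ inferInstance) hm, ?_⟩
  rw [← Category.assoc, hi]

theorem presentation_aux (F : FactorizationSystem K) {κ : Cardinal.{v}} [HasColimits K]
    (hconv : Convenient F κ) (S : Set K) (X : K)
    (P : DirectedColimitPresentation (⊤ : MorphismProperty K) κ S X) :
    Nonempty (DirectedColimitPresentation F.M κ (quotientSet F S) X) := by
  obtain ⟨I, hI, D, hS, -, c, rfl, hc⟩ := P
  choose B e m hB he hm hem using fun i => factor_mem F S (hS i) (c.ι.app i)
  have hex : ∀ {i j : I} (f : i ⟶ j), ∃! d : B i ⟶ B j,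
      e i ≫ d = D.map f ≫ e j ∧ d ≫ m j = m i := fun {i j} f =>
    F.orth (e i) (m j) (he i) (hm j) _ _ (by simp [hem])
  choose b hb hbu using @hex
  let BF : I ⥤ K :=
    { obj := B
      map := fun f => b f
      map_id := fun i => (hbu (𝟙 i) (𝟙 _) ⟨by simp, by simp⟩).symm
      map_comp := fun {i j k} f g => (hbu (f ≫ g) (b f ≫ b g)
        ⟨by rw [← Category.assoc, (hb f).1, Category.assoc, (hb g).1, D.map_comp,
            Category.assoc], by rw [Category.assoc, (hb g).2, (hb f).2]⟩).symm }
  let t : Cocone BF :=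
    { pt := c.pt
      ι := { app := m
             naturality := fun i j f => by
              change b f ≫ m j = m i ≫ 𝟙 _
              rw [(hb f).2, Category.comp_id] } }
  have hBM : DiagramInM F.M BF := fun i j h =>
    F.M_cancel (b (homOfLE h)) (m j) (hm j) (by rw [(hb _).2]; exact hm i)
  let p : colimit BF ⟶ c.pt := (colimit.isColimit BF).desc t
  have hp : F.M p := hconv.M_desc I hI BF hBM _ (colimit.isColimit BF) t hm
  have hιp : ∀ i, colimit.ι BF i ≫ p = m i := fun i => (colimit.isColimit BF).fac t i
  let s : c.pt ⟶ colimit BF := hc.desc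
    { pt := colimit BF
      ι := { app := fun i => e i ≫ colimit.ι BF i
             naturality := fun i j f => by
              have h1 : b f ≫ colimit.ι BF j = colimit.ι BF i := colimit.w BF f
              have h2 := (hb f).1
              change D.map f ≫ e j ≫ colimit.ι BF j = (e i ≫ colimit.ι BF i) ≫ 𝟙 _
              rw [← Category.assoc, ← h2, Category.assoc, h1, Category.comp_id] } }
  have hcs : ∀ i, c.ι.app i ≫ s = e i ≫ colimit.ι BF i := fun i => hc.fac _ i
  have hsp : s ≫ p = 𝟙 _ := hc.hom_ext fun i => by
    rw [← Category.assoc, hcs, Category.assoc, hιp, hem]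
    exact (Category.comp_id _).symm
  have hps : p ≫ s = 𝟙 _ := colimit.hom_ext fun i => by
    rw [← Category.assoc, hιp, Category.comp_id]
    obtain ⟨d, -, hu⟩ := F.orth (e i) p (he i) hp (e i ≫ colimit.ι BF i) (m i)
      (by rw [Category.assoc, hιp])
    rw [hu (m i ≫ s) ⟨by rw [← Category.assoc, hem, hcs], by
      rw [Category.assoc, hsp]; exact Category.comp_id _⟩, hu (colimit.ι BF i) ⟨rfl, hιp i⟩]
  have hiso : IsIso ((colimit.isColimit BF).desc t) := ⟨s, hps, hsp⟩
  exact ⟨{ I := I, directed := hI, D := BF, mem := hB, inM := hBM, c := t, pt_eq := rfl,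
           isColimit := IsColimit.ofPointIso (colimit.isColimit BF) }⟩

/-- A locally λ-presentable category is `M`-locally λ-generated for
every λ-convenient factorization system `(E, M)` on it. -/
theorem locallyPresentable_implies_locallyGenerated
    (F : FactorizationSystem K) (κ : Cardinal.{v}) (hκ : κ.IsRegular)
    (hP : LocallyPresentable K κ) (hconv : Convenient F κ) :
    ∃ S : Set K, IsLocallyGenerated F κ S := by
  obtain ⟨hcol, S, hS, hgen, hpres⟩ := hP
  refine ⟨quotientSet F S, hcol, hconv, ?_, ?_, fun X => ?_⟩
  · have : ∀ A : S, Small.{v} (Quot (QuotientRel F.E A.1)) := fun A => hconv.cowellpowered A.1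
    exact small_range _
  · rintro _ ⟨⟨A, q⟩, rfl⟩
    exact isGenerated_quotient F hκ hconv (hgen A.1 A.2) q.out.2.1 q.out.2.2
  · obtain ⟨P⟩ := hpres X
    exact presentation_aux F hconv S X P

end LocallyGen
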